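/- Let a20, a11, a10, a01, a00 and a20', a11', a10', a01', a00' and g be smooth real functions on ℝ², and define L u = ∂_x∂_x∂_y u + a20·∂_x∂_x u + a11·∂_x∂_y u + a10·∂_x u + a01·∂_y u + a00·u, and L' analogously with the primed coefficients. If L' u = e^{−g}·L(e^{g}·u) for every smooth u : ℝ² → ℝ, then the Laplace invariants agree: a10' − (a11'·a20' + 2·∂_x a20') = a10 − (a11·a20 + 2·∂_x a20) and a01' − ((a11')²/4 + (∂_x a11')/2) = a01 − (a11²/4 + (∂_x a11)/2). -/

import Mathlib

noncomputable def dx (f : (Fin 2 → ℝ) → ℝ) : (Fin 2 → ℝ) → ℝ :=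
  fun p => fderiv ℝ f p (Pi.single 0 1)

noncomputable def dy (f : (Fin 2 → ℝ) → ℝ) : (Fin 2 → ℝ) → ℝ :=
  fun p => fderiv ℝ f p (Pi.single 1 1)

theorem contDiff_dx {f : (Fin 2 → ℝ) → ℝ} (hf : ContDiff ℝ (⊤ : ℕ∞) f) :
    ContDiff ℝ (⊤ : ℕ∞) (dx f) :=
  (hf.fderiv_right (m := (⊤ : ℕ∞)) (by simp)).clm_apply contDiff_const

theorem contDiff_dy {f : (Fin 2 → ℝ) → ℝ} (hf : ContDiff ℝ (⊤ : ℕ∞) f) :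
    ContDiff ℝ (⊤ : ℕ∞) (dy f) :=
  (hf.fderiv_right (m := (⊤ : ℕ∞)) (by simp)).clm_apply contDiff_const

theorem dx_add {f h : (Fin 2 → ℝ) → ℝ} (hf : ContDiff ℝ (⊤ : ℕ∞) f)
    (hh : ContDiff ℝ (⊤ : ℕ∞) h) : dx (fun y => f y + h y) = fun y => dx f y + dx h y := by
  funext p
  simp only [dx]
  rw [fderiv_fun_add (hf.differentiable (by simp) p) (hh.differentiable (by simp) p)]
  simp

theorem dx_mul {f h : (Fin 2 → ℝ) → ℝ} (hf : ContDiff ℝ (⊤ : ℕ∞) f)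
    (hh : ContDiff ℝ (⊤ : ℕ∞) h) :
    dx (fun y => f y * h y) = fun y => f y * dx h y + dx f y * h y := by
  funext p
  simp only [dx]
  rw [fderiv_fun_mul (hf.differentiable (by simp) p) (hh.differentiable (by simp) p)]
  simp [mul_comm]

theorem dy_mul {f h : (Fin 2 → ℝ) → ℝ} (hf : ContDiff ℝ (⊤ : ℕ∞) f)
    (hh : ContDiff ℝ (⊤ : ℕ∞) h) :
    dy (fun y => f y * h y) = fun y => f y * dy h y + dy f y * h y := by
  funext p
  simp only [dy]
  rw [fderiv_fun_mul (hf.differentiable (by simp) p) (hh.differentiable (by simp) p)]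
  simp [mul_comm]

theorem dx_exp_mul {g u : (Fin 2 → ℝ) → ℝ} (hg : ContDiff ℝ (⊤ : ℕ∞) g)
    (hu : ContDiff ℝ (⊤ : ℕ∞) u) :
    dx (fun y => Real.exp (g y) * u y) =
      fun y => Real.exp (g y) * (dx u y + dx g y * u y) := by
  rw [dx_mul hg.exp hu]
  funext p
  simp only [dx]
  rw [fderiv_exp (hg.differentiable (by simp) p)]
  simp
  ring

theorem dy_exp_mul {g u : (Fin 2 → ℝ) → ℝ} (hg : ContDiff ℝ (⊤ : ℕ∞) g)
    (hu : ContDiff ℝ (⊤ : ℕ∞) u) :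
    dy (fun y => Real.exp (g y) * u y) =
      fun y => Real.exp (g y) * (dy u y + dy g y * u y) := by
  rw [dy_mul hg.exp hu]
  funext p
  simp only [dy]
  rw [fderiv_exp (hg.differentiable (by simp) p)]
  simp
  ring

theorem dx_dx_exp_mul {g u : (Fin 2 → ℝ) → ℝ} (hg : ContDiff ℝ (⊤ : ℕ∞) g)
    (hu : ContDiff ℝ (⊤ : ℕ∞) u) :
    dx (dx (fun y => Real.exp (g y) * u y)) =
      fun y => Real.exp (g y) *
        (dx (dx u) y + 2 * dx g y * dx u y + (dx (dx g) y + dx g y ^ 2) * u y) := by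
  have hgx := contDiff_dx hg
  have hux := contDiff_dx hu
  rw [dx_exp_mul hg hu, dx_exp_mul hg (hux.add (hgx.mul hu)),
    dx_add hux (hgx.mul hu), dx_mul hgx hu]
  funext p
  ring

theorem dx_dy_exp_mul {g u : (Fin 2 → ℝ) → ℝ} (hg : ContDiff ℝ (⊤ : ℕ∞) g)
    (hu : ContDiff ℝ (⊤ : ℕ∞) u) :
    dx (dy (fun y => Real.exp (g y) * u y)) =
      fun y => Real.exp (g y) * (dx (dy u) y + dy g y * dx u y + dx g y * dy u y
        + (dx (dy g) y + dx g y * dy g y) * u y) := by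
  have hgy := contDiff_dy hg
  have huy := contDiff_dy hu
  rw [dy_exp_mul hg hu, dx_exp_mul hg (huy.add (hgy.mul hu)),
    dx_add huy (hgy.mul hu), dx_mul hgy hu]
  funext p
  ring

theorem dx_dx_dy_exp_mul {g u : (Fin 2 → ℝ) → ℝ} (hg : ContDiff ℝ (⊤ : ℕ∞) g)
    (hu : ContDiff ℝ (⊤ : ℕ∞) u) :
    dx (dx (dy (fun y => Real.exp (g y) * u y))) =
      fun y => Real.exp (g y) *
        (dx (dx (dy u)) y + dy g y * dx (dx u) y + 2 * dx g y * dx (dy u) y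
          + 2 * (dx (dy g) y + dx g y * dy g y) * dx u y
          + (dx (dx g) y + dx g y ^ 2) * dy u y
          + (dx (dx (dy g)) y + 2 * dx g y * dx (dy g) y
            + (dx (dx g) y + dx g y ^ 2) * dy g y) * u y) := by
  have hgy := contDiff_dy hg
  have huy := contDiff_dy hu
  have hux := contDiff_dx hu
  have hgxy := contDiff_dx hgy
  rw [dy_exp_mul hg hu, dx_dx_exp_mul hg (huy.add (hgy.mul hu)),
    dx_add huy (hgy.mul hu), dx_mul hgy hu,
    dx_add (contDiff_dx huy) ((hgy.mul hux).add (hgxy.mul hu)),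
    dx_add (hgy.mul hux) (hgxy.mul hu), dx_mul hgy hux, dx_mul hgxy hu]
  funext p
  ring

theorem dx_const (c : ℝ) : dx (fun _ => c) = fun _ => 0 := by
  funext p
  simp [dx]

theorem fderiv_coord_sub (i : Fin 2) (c : ℝ) (p v : Fin 2 → ℝ) :
    fderiv ℝ (fun y : Fin 2 → ℝ => y i - c) p v = v i := by
  rw [fderiv_sub_const, (hasFDerivAt_apply i p).fderiv]
  rfl

theorem dx_coord_zero (c : ℝ) : dx (fun y => y 0 - c) = fun _ => 1 := by
  funext p
  simp [dx, fderiv_coord_sub]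

theorem dx_coord_one (c : ℝ) : dx (fun y => y 1 - c) = fun _ => 0 := by
  funext p
  simp [dx, fderiv_coord_sub]

theorem dy_coord_zero (c : ℝ) : dy (fun y => y 0 - c) = fun _ => 0 := by
  funext p
  simp [dy, fderiv_coord_sub]

theorem dy_coord_one (c : ℝ) : dy (fun y => y 1 - c) = fun _ => 1 := by
  funext p
  simp [dy, fderiv_coord_sub]

theorem contDiff_coord_sub (i : Fin 2) (c : ℝ) :
    ContDiff ℝ (⊤ : ℕ∞) (fun y : Fin 2 → ℝ => y i - c) :=
  (contDiff_apply ℝ ℝ i).sub contDiff_const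

theorem laplace_invariants_xxy
    (a20 a11 a10 a01 a00 a20' a11' a10' a01' a00' g : (Fin 2 → ℝ) → ℝ)
    (h20 : ContDiff ℝ (⊤ : ℕ∞) a20) (h11 : ContDiff ℝ (⊤ : ℕ∞) a11) (h10 : ContDiff ℝ (⊤ : ℕ∞) a10)
    (h01 : ContDiff ℝ (⊤ : ℕ∞) a01) (h00 : ContDiff ℝ (⊤ : ℕ∞) a00)
    (h20' : ContDiff ℝ (⊤ : ℕ∞) a20') (h11' : ContDiff ℝ (⊤ : ℕ∞) a11') (h10' : ContDiff ℝ (⊤ : ℕ∞) a10')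
    (h01' : ContDiff ℝ (⊤ : ℕ∞) a01') (h00' : ContDiff ℝ (⊤ : ℕ∞) a00')
    (hg : ContDiff ℝ (⊤ : ℕ∞) g)
    (hgauge : ∀ u : (Fin 2 → ℝ) → ℝ, ContDiff ℝ (⊤ : ℕ∞) u → ∀ x,
      dx (dx (dy u)) x + a20' x * dx (dx u) x + a11' x * dx (dy u) x
        + a10' x * dx u x + a01' x * dy u x + a00' x * u x =
      Real.exp (-(g x)) *
        (dx (dx (dy (fun y => Real.exp (g y) * u y))) x
          + a20 x * dx (dx (fun y => Real.exp (g y) * u y)) x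
          + a11 x * dx (dy (fun y => Real.exp (g y) * u y)) x
          + a10 x * dx (fun y => Real.exp (g y) * u y) x
          + a01 x * dy (fun y => Real.exp (g y) * u y) x
          + a00 x * (Real.exp (g x) * u x))) :
    (∀ x, a10' x - (a11' x * a20' x + 2 * dx a20' x) =
          a10 x - (a11 x * a20 x + 2 * dx a20 x)) ∧
    (∀ x, a01' x - ((a11' x) ^ 2 / 4 + dx a11' x / 2) =
          a01 x - ((a11 x) ^ 2 / 4 + dx a11 x / 2)) := by
  have key : ∀ u : (Fin 2 → ℝ) → ℝ, ContDiff ℝ (⊤ : ℕ∞) u → ∀ x, u x = 0 →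
      (a20' x - a20 x - dy g x) * dx (dx u) x + (a11' x - a11 x - 2 * dx g x) * dx (dy u) x
        + (a10' x - a10 x - 2 * (dx (dy g) x + dx g x * dy g x) - 2 * a20 x * dx g x
          - a11 x * dy g x) * dx u x
        + (a01' x - a01 x - (dx (dx g) x + dx g x ^ 2) - a11 x * dx g x) * dy u x = 0 := by
    intro u hu x hx
    have h := hgauge u hu x
    rw [dx_dx_dy_exp_mul hg hu, dx_dx_exp_mul hg hu, dx_dy_exp_mul hg hu,
      dx_exp_mul hg hu, dy_exp_mul hg hu, Real.exp_neg] at h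
    field_simp at h
    rw [hx] at h
    linear_combination h
  have e10 : ∀ x, a10' x = a10 x + 2 * (dx (dy g) x + dx g x * dy g x)
      + 2 * a20 x * dx g x + a11 x * dy g x := fun x => by
    have h := key _ (contDiff_coord_sub 0 (x 0)) x (sub_self _)
    simp only [dx_coord_zero, dy_coord_zero, dx_const] at h
    linear_combination h
  have e01 : ∀ x, a01' x = a01 x + (dx (dx g) x + dx g x ^ 2) + a11 x * dx g x := fun x => by
    have h := key _ (contDiff_coord_sub 1 (x 1)) x (sub_self _)
    simp only [dx_coord_one, dy_coord_one, dx_const] at h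
    linear_combination h
  have e20 : a20' = fun x => a20 x + dy g x := funext fun x => by
    have hX := contDiff_coord_sub 0 (x 0)
    have h := key _ (hX.mul hX) x (by simp)
    simp only [dx_mul hX hX, dy_mul hX hX, dx_coord_zero, dy_coord_zero, mul_one, one_mul,
      mul_zero, zero_mul, add_zero, dx_add hX hX, dx_const, sub_self] at h
    linear_combination h / 2
  have e11 : a11' = fun x => a11 x + 2 * dx g x := funext fun x => by
    have hX := contDiff_coord_sub 0 (x 0)
    have hY := contDiff_coord_sub 1 (x 1)
    have h := key _ (hX.mul hY) x (by simp)
    simp only [dx_mul hX hY, dy_mul hX hY, dx_coord_zero, dy_coord_zero, dx_coord_one,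
      dy_coord_one, mul_one, one_mul, mul_zero, zero_mul, add_zero, zero_add, sub_self] at h
    linear_combination h
  have hgx := contDiff_dx hg
  refine ⟨fun x => ?_, fun x => ?_⟩
  · rw [e10, e20, e11, dx_add h20 (contDiff_dy hg)]
    ring
  · rw [e01, e11, dx_add h11 (contDiff_const.mul hgx), dx_mul contDiff_const hgx, dx_const]
    ring
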